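/- arXiv:2511.17157 — 2 statements merged into one kernel-verified Lean document; each statement's English description precedes it below -/
import Mathlib

section
/- (Convergence rate of GPGM.) Under the setting of the Güler-type accelerated proximal gradient method: f : ℝⁿ → ℝ convex differentiable with f(x') ≤ f(x) + ⟨∇f(x), x' − x⟩ + (L/2)‖x' − x‖² for all x, x' (L ≥ 0), g : ℝⁿ → ℝ convex, F = f + g, x* a minimizer of F, γ > 0 with α := L/γ ∈ (0, 1], t₀ = 0, t_k = (1 + √(1 + 4 t_{k−1}²))/2, θ_k = 1/t_k, τ_k = γ θ_k, x¹ = x̂¹ = x_ag¹, and for k ≥ 1: x_md^k = (1 − θ_k) x_ag^k + θ_k x̂^k; x^{k+1} a minimizer over ℝⁿ of x ↦ g(x) + (τ_k/2)‖x − (x̂^k − ∇f(x_md^k)/τ_k)‖²; x̂^{k+1} = (α − 1) x̂^k + (2 − α) x^{k+1}; x_ag^{k+1} = (1 − θ_k) x_ag^k + θ_k x^{k+1}. Then for every k ≥ 1: F(x_ag^{k+1}) − F(x*) ≤ (2γ/((2 − α)·(k + 1)²))·(‖x̂¹ − x*‖² − ‖x̂^{k+1} − x*‖²). -/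
open scoped RealInnerProductSpace

section ConvexMinimization

variable {E : Type*} [NormedAddCommGroup E] [InnerProductSpace ℝ E]

theorem ConvexOn.add_inner_le_of_hasGradientAt [CompleteSpace E] {f : E → ℝ} {v x : E}
    (hf : ConvexOn ℝ Set.univ f) (hv : HasGradientAt f v x) (y : E) :
    f x + ⟪v, y - x⟫ ≤ f y := by
  have hline : HasDerivAt (f ∘ AffineMap.lineMap x y) ⟪v, y - x⟫ (0 : ℝ) := by
    have hx : HasFDerivAt f (InnerProductSpace.toDual ℝ E v)
        (AffineMap.lineMap x y (0 : ℝ)) := by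
      simpa using hv.hasFDerivAt
    simpa using hx.comp_hasDerivAt (0 : ℝ) AffineMap.hasDerivAt_lineMap
  have hconv : ConvexOn ℝ Set.univ (f ∘ AffineMap.lineMap (k := ℝ) x y) := by
    simpa using hf.comp_affineMap (AffineMap.lineMap (k := ℝ) x y)
  have hslope := hconv.le_slope_of_hasDerivAt (Set.mem_univ 0) (Set.mem_univ 1) one_pos hline
  simp [slope_def_field] at hslope
  linarith

/-- The variational inequality characterizing a proximal point. -/
theorem ConvexOn.add_inner_le_of_prox {g : E → ℝ} {τ : ℝ} {c p : E}
    (hg : ConvexOn ℝ Set.univ g) (hτ : 0 ≤ τ)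
    (hp : ∀ y, g p + τ / 2 * ‖p - c‖ ^ 2 ≤ g y + τ / 2 * ‖y - c‖ ^ 2) (y : E) :
    g p + τ * ⟪p - c, p - y⟫ ≤ g y := by
  have hseg : ∀ s : ℝ, 0 < s → s ≤ 1 →
      g p + τ * ⟪p - c, p - y⟫ - g y ≤ s * (τ / 2 * ‖p - y‖ ^ 2) := by
    intro s hs hs1
    have hconv := hg.2 (Set.mem_univ p) (Set.mem_univ y) (sub_nonneg.2 hs1) hs.le (by ring)
    have hmin := hp ((1 - s) • p + s • y)
    have hexp : ‖(1 - s) • p + s • y - c‖ ^ 2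
        = ‖p - c‖ ^ 2 - 2 * (s * ⟪p - c, p - y⟫) + s ^ 2 * ‖p - y‖ ^ 2 := by
      rw [show (1 - s) • p + s • y - c = (p - c) - s • (p - y) by module, norm_sub_sq_real,
        inner_smul_right, norm_smul, mul_pow, Real.norm_eq_abs, sq_abs]
    rw [hexp] at hmin
    simp only [smul_eq_mul] at hconv
    refine le_of_mul_le_mul_left ?_ hs
    linarith
  by_contra! hlt
  have hb : 0 ≤ τ / 2 * ‖p - y‖ ^ 2 := by positivity
  set b := τ / 2 * ‖p - y‖ ^ 2
  set a := g p + τ * ⟪p - c, p - y⟫ - g y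
  have ha : 0 < a := sub_pos.2 hlt
  have hab : 0 < a + b := by positivity
  have h := hseg (a / (a + b)) (by positivity) ((div_le_one hab).2 (by linarith))
  rw [div_mul_eq_mul_div, le_div_iff₀ hab] at h
  nlinarith

/-- One step of the accelerated proximal gradient method decreases the optimality gap up to a
telescoping term. -/
theorem accelerated_prox_step [CompleteSpace E] {f g : E → ℝ} {f' : E → E} {L γ θ : ℝ}
    {u z p m xstar : E} (hγ : 0 < γ) (hL : L / γ < 2) (hθ : 0 < θ) (hθ1 : θ ≤ 1)
    (hdiff : HasGradientAt f (f' m) m)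
    (hf : ConvexOn ℝ Set.univ f) (hg : ConvexOn ℝ Set.univ g)
    (hsmooth : ∀ y, f y ≤ f m + ⟪f' m, y - m⟫ + L / 2 * ‖y - m‖ ^ 2)
    (hm : m = (1 - θ) • u + θ • z)
    (hp : ∀ y, g p + γ * θ / 2 * ‖p - (z - (1 / (γ * θ)) • f' m)‖ ^ 2
      ≤ g y + γ * θ / 2 * ‖y - (z - (1 / (γ * θ)) • f' m)‖ ^ 2) :
    f ((1 - θ) • u + θ • p) + g ((1 - θ) • u + θ • p) - (f xstar + g xstar)
      ≤ (1 - θ) * (f u + g u - (f xstar + g xstar))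
        + θ ^ 2 * (γ / (2 * (2 - L / γ)) * (‖z - xstar‖ ^ 2
          - ‖(L / γ - 1) • z + (2 - L / γ) • p - xstar‖ ^ 2)) := by
  have hprox := hg.add_inner_le_of_prox (by positivity) hp xstar
  have hfu := hf.add_inner_le_of_hasGradientAt hdiff u
  have hfs := hf.add_inner_le_of_hasGradientAt hdiff xstar
  have hgc : g ((1 - θ) • u + θ • p) ≤ (1 - θ) * g u + θ * g p :=
    hg.2 (Set.mem_univ u) (Set.mem_univ p) (sub_nonneg.2 hθ1) hθ.le (by ring)
  have hup := hsmooth ((1 - θ) • u + θ • p)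
  have hmove : (1 - θ) • u + θ • p - m = θ • (p - z) := by rw [hm]; module
  have hinner : ⟪f' m, θ • (p - z)⟫
      = (1 - θ) * ⟪f' m, u - m⟫ + θ * ⟪f' m, xstar - m⟫ + θ * ⟪f' m, p - xstar⟫ := by
    rw [← inner_smul_right, ← inner_smul_right, ← inner_smul_right, ← inner_add_right,
      ← inner_add_right, ← hmove]
    congr 1
    module
  have hnorm : ‖θ • (p - z)‖ ^ 2 = θ ^ 2 * ‖p - z‖ ^ 2 := by
    rw [norm_smul, mul_pow, Real.norm_eq_abs, sq_abs]
  rw [hmove, hinner, hnorm] at hup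
  have hprox' : γ * θ * ⟪p - (z - (1 / (γ * θ)) • f' m), p - xstar⟫
      = γ * θ * ⟪p - z, p - xstar⟫ + ⟪f' m, p - xstar⟫ := by
    rw [show p - (z - (1 / (γ * θ)) • f' m) = (p - z) + (1 / (γ * θ)) • f' m by module,
      inner_add_left, real_inner_smul_left]
    field_simp
  rw [hprox'] at hprox
  have htel : γ / (2 * (2 - L / γ)) * (‖z - xstar‖ ^ 2
      - ‖(L / γ - 1) • z + (2 - L / γ) • p - xstar‖ ^ 2)
      = L / 2 * ‖p - z‖ ^ 2 - γ * ⟪p - z, p - xstar⟫ := by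
    have hα : 2 - L / γ ≠ 0 := by linarith
    have hL' : L = L / γ * γ := by field_simp
    rw [show (L / γ - 1) • z + (2 - L / γ) • p - xstar
        = (z - xstar) + (2 - L / γ) • (p - z) by module,
      show p - xstar = (z - xstar) + (p - z) by module, norm_add_sq_real, inner_smul_right,
      norm_smul, mul_pow, Real.norm_eq_abs, sq_abs, inner_add_right,
      real_inner_self_eq_norm_sq, real_inner_comm (p - z) (z - xstar)]
    generalize L / γ = α at *
    subst hL'
    field_simp
    ring
  rw [htel]
  have hu := mul_le_mul_of_nonneg_left hfu (sub_nonneg.2 hθ1)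
  have hs := mul_le_mul_of_nonneg_left hfs hθ.le
  have hq := mul_le_mul_of_nonneg_left hprox hθ.le
  linarith

end ConvexMinimization

theorem half_succ_le_of_accelerated_rec {t : ℕ → ℝ} (ht0 : t 0 = 0)
    (htrec : ∀ k, t (k + 1) = (1 + Real.sqrt (1 + 4 * t k ^ 2)) / 2) (k : ℕ) :
    ((k : ℝ) + 2) / 2 ≤ t (k + 1) := by
  induction k with
  | zero => simp [htrec, ht0]
  | succ k ih =>
    rw [htrec (k + 1)]
    have h : 2 * t (k + 1) ≤ Real.sqrt (1 + 4 * t (k + 1) ^ 2) :=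
      Real.le_sqrt_of_sq_le (by linarith)
    push_cast
    linarith

theorem sq_sub_self_of_accelerated_rec {t : ℕ → ℝ}
    (htrec : ∀ k, t (k + 1) = (1 + Real.sqrt (1 + 4 * t k ^ 2)) / 2) (k : ℕ) :
    t (k + 1) ^ 2 - t (k + 1) = t k ^ 2 := by
  have h := Real.sq_sqrt (show 0 ≤ 1 + 4 * t k ^ 2 by positivity)
  rw [htrec]
  linarith

theorem gpgm_convergence_rate {n : ℕ}
    (f g : EuclideanSpace ℝ (Fin n) → ℝ)
    (f' : EuclideanSpace ℝ (Fin n) → EuclideanSpace ℝ (Fin n))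
    (L γ : ℝ) (hL : 0 ≤ L) (hγ : 0 < γ) (hα : L / γ ∈ Set.Ioc (0 : ℝ) 1)
    (hdiff : ∀ x, HasGradientAt f (f' x) x)
    (hfconv : ConvexOn ℝ Set.univ f)
    (hgconv : ConvexOn ℝ Set.univ g)
    (hsmooth : ∀ x x', f x' ≤ f x + ⟪f' x, x' - x⟫ + L / 2 * ‖x' - x‖ ^ 2)
    (xstar : EuclideanSpace ℝ (Fin n))
    (hstar : ∀ x, f xstar + g xstar ≤ f x + g x)
    (t θ τ : ℕ → ℝ)
    (ht0 : t 0 = 0)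
    (htrec : ∀ k : ℕ, t (k + 1) = (1 + Real.sqrt (1 + 4 * t k ^ 2)) / 2)
    (hθ : ∀ k : ℕ, 1 ≤ k → θ k = 1 / t k)
    (hτ : ∀ k : ℕ, 1 ≤ k → τ k = γ * θ k)
    (x xhat xag xmd : ℕ → EuclideanSpace ℝ (Fin n))
    (hinit1 : x 1 = xhat 1) (hinit2 : x 1 = xag 1)
    (hmd : ∀ k : ℕ, 1 ≤ k → xmd k = (1 - θ k) • xag k + θ k • xhat k)
    (hmin : ∀ k : ℕ, 1 ≤ k → ∀ y : EuclideanSpace ℝ (Fin n),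
      g (x (k + 1)) + τ k / 2 * ‖x (k + 1) - (xhat k - (1 / τ k) • f' (xmd k))‖ ^ 2
        ≤ g y + τ k / 2 * ‖y - (xhat k - (1 / τ k) • f' (xmd k))‖ ^ 2)
    (hhat : ∀ k : ℕ, 1 ≤ k →
      xhat (k + 1) = (L / γ - 1) • xhat k + (2 - L / γ) • x (k + 1))
    (hag : ∀ k : ℕ, 1 ≤ k →
      xag (k + 1) = (1 - θ k) • xag k + θ k • x (k + 1)) :
    ∀ k : ℕ, 1 ≤ k →
      (f (xag (k + 1)) + g (xag (k + 1))) - (f xstar + g xstar)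
        ≤ 2 * γ / ((2 - L / γ) * ((k : ℝ) + 1) ^ 2)
          * (‖xhat 1 - xstar‖ ^ 2 - ‖xhat (k + 1) - xstar‖ ^ 2) := by
  have htpos : ∀ k : ℕ, 1 ≤ t (k + 1) := fun k => by
    have h := half_succ_le_of_accelerated_rec ht0 htrec k
    have hk : (0 : ℝ) ≤ k := k.cast_nonneg
    linarith
  have hα2 : 0 < 2 - L / γ := by linarith [hα.2]
  have hstep : ∀ k : ℕ,
      t (k + 1) ^ 2 * (f (xag (k + 2)) + g (xag (k + 2)) - (f xstar + g xstar))
        ≤ t k ^ 2 * (f (xag (k + 1)) + g (xag (k + 1)) - (f xstar + g xstar))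
          + γ / (2 * (2 - L / γ))
            * (‖xhat (k + 1) - xstar‖ ^ 2 - ‖xhat (k + 2) - xstar‖ ^ 2) := by
    intro k
    have hk : 1 ≤ k + 1 := k.succ_pos
    have hpos : 0 < t (k + 1) := one_pos.trans_le (htpos k)
    have hθk := hθ (k + 1) hk
    have hmink := hmin (k + 1) hk
    rw [hτ (k + 1) hk] at hmink
    have h := accelerated_prox_step (xstar := xstar) hγ (by linarith)
      (by rw [hθk]; positivity) (by rw [hθk]; exact (div_le_one hpos).2 (htpos k))
      (hdiff _) hfconv hgconv (hsmooth _) (hmd (k + 1) hk) hmink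
    rw [← hag (k + 1) hk, ← hhat (k + 1) hk, hθk] at h
    have h' := mul_le_mul_of_nonneg_left h (sq_nonneg (t (k + 1)))
    refine h'.trans_eq ?_
    rw [← sq_sub_self_of_accelerated_rec htrec k]
    field_simp
  have hsum : ∀ k : ℕ,
      t k ^ 2 * (f (xag (k + 1)) + g (xag (k + 1)) - (f xstar + g xstar))
        ≤ γ / (2 * (2 - L / γ))
          * (‖xhat 1 - xstar‖ ^ 2 - ‖xhat (k + 1) - xstar‖ ^ 2) := by
    intro k
    induction k with
    | zero => simp [ht0]
    | succ k ih => linarith [hstep k]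
  intro k hk
  obtain ⟨j, rfl⟩ := Nat.exists_eq_add_of_le' hk
  have hgap := sub_nonneg.2 (hstar (xag (j + 1 + 1)))
  have htj : (((j + 1 : ℕ) : ℝ) + 1) / 2 ≤ t (j + 1) := by
    have h := half_succ_le_of_accelerated_rec ht0 htrec j
    push_cast
    linarith
  have hsq := mul_le_mul_of_nonneg_right (pow_le_pow_left₀ (by positivity) htj 2) hgap
  have h := hsq.trans (hsum (j + 1))
  have hc : (0 : ℝ) < ((((j + 1 : ℕ) : ℝ) + 1) / 2) ^ 2 := by positivity
  refine ((le_div_iff₀' hc).2 h).trans_eq ?_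
  field_simp
end

section
/- (Telescoped GLALM bound.) Under the GLALM iteration with parameters θ_k = 2/(k+1), γ_k = kγ, κ_k = κγk/2, P^k = (η/k)I, where γ > 0, η > 0, α := 2L/η ∈ (0, 1), κ ∈ (1, 2), initialized with x¹ = x̂¹ = x_ag¹ ∈ X and z¹ = ẑ¹ = 0, applied to min_{x ∈ X} F(x) = f(x) + g(x) s.t. A x = b (with X ⊆ ℝⁿ closed convex, f convex differentiable satisfying f(x') ≤ f(x) + ⟨∇f(x), x' − x⟩ + (L/2)‖x' − x‖², g convex, A ∈ ℝ^{l×n}, b ∈ ℝˡ), and with x* ∈ X a point satisfying A x* = b: for every z ∈ ℝˡ and every k ≥ 1, k(k+1)·(F(x_ag^{k+1}) − F(x*) − ⟨z, A x_ag^{k+1} − b⟩) ≤ (η/(2 − α))·‖x¹ − x*‖² + (1/(κ γ))·‖z‖². -/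
open scoped RealInnerProductSpace

/-- First-order inequality of a differentiable convex function. -/
theorem ConvexOn.add_inner_gradient_le {E : Type*} [NormedAddCommGroup E] [InnerProductSpace ℝ E]
    [CompleteSpace E] {f : E → ℝ} {v x : E} (hf : ConvexOn ℝ Set.univ f)
    (hv : HasGradientAt f v x) (y : E) : f x + ⟪v, y - x⟫ ≤ f y := by
  have hline : HasDerivAt (fun t : ℝ => f (AffineMap.lineMap x y t)) ⟪v, y - x⟫ 0 := by
    have h : HasFDerivAt f (InnerProductSpace.toDual ℝ E v) (AffineMap.lineMap x y (0 : ℝ)) := by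
      simpa using hv.hasFDerivAt
    simpa [Function.comp_def] using h.comp_hasDerivAt (0 : ℝ) AffineMap.hasDerivAt_lineMap
  have hconv : ConvexOn ℝ Set.univ (fun t : ℝ => f (AffineMap.lineMap x y t)) :=
    hf.comp_affineMap (AffineMap.lineMap x y)
  have h := hconv.le_slope_of_hasDerivAt (Set.mem_univ 0) (Set.mem_univ 1) one_pos hline
  simp only [slope_def_field, sub_zero, div_one, AffineMap.lineMap_apply_one,
    AffineMap.lineMap_apply_zero] at h
  linarith

/-- If `t * s ≤ t ^ 2 * c` for all `t ∈ (0, 1]`, then `s ≤ 0`. -/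
theorem nonpos_of_forall_mul_le_sq_mul {s c : ℝ}
    (h : ∀ t : ℝ, 0 < t → t ≤ 1 → t * s ≤ t ^ 2 * c) : s ≤ 0 := by
  by_contra! hs
  have hc : 0 < |c| + s := by positivity
  have ht : 0 < s / (2 * (|c| + s)) := by positivity
  have h1 : s / (2 * (|c| + s)) ≤ 1 := by
    rw [div_le_one (by positivity)]
    linarith [abs_nonneg c]
  have h2 := h _ ht h1
  have h3 : s ≤ s / (2 * (|c| + s)) * c := by
    refine le_of_mul_le_mul_left ?_ ht
    linarith
  have h4 : s / (2 * (|c| + s)) * (|c| + s) = s / 2 := by field_simp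
  nlinarith [le_abs_self c, mul_pos ht hs]

section

variable {E H : Type*} [NormedAddCommGroup E] [InnerProductSpace ℝ E]
  [NormedAddCommGroup H] [InnerProductSpace ℝ H]

/-- Variational inequality for a minimizer of a convex function plus linear and quadratic terms. -/
theorem variational_inequality_of_isMinimizer {X : Set E} (hX : Convex ℝ X) {g : E → ℝ}
    (hg : ConvexOn ℝ Set.univ g) (T : E →ₗ[ℝ] H) (b : H) (c w u : E) (p q : ℝ)
    (hu : u ∈ X)
    (hmin : ∀ y ∈ X, ⟪c, u⟫ + g u + p / 2 * ‖T u - b‖ ^ 2 + q / 2 * ‖u - w‖ ^ 2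
      ≤ ⟪c, y⟫ + g y + p / 2 * ‖T y - b‖ ^ 2 + q / 2 * ‖y - w‖ ^ 2)
    {y : E} (hy : y ∈ X) :
    ⟪c, u - y⟫ + g u - g y + p * ⟪T u - b, T u - T y⟫ + q * ⟪u - w, u - y⟫ ≤ 0 := by
  refine nonpos_of_forall_mul_le_sq_mul
    (c := p / 2 * ‖T u - T y‖ ^ 2 + q / 2 * ‖u - y‖ ^ 2) fun t ht ht1 => ?_
  have hmem : (1 - t) • u + t • y ∈ X := hX hu hy (by linarith) ht.le (by ring)
  have hgt : g ((1 - t) • u + t • y) ≤ (1 - t) * g u + t * g y := by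
    simpa using hg.2 (Set.mem_univ u) (Set.mem_univ y) (by linarith : 0 ≤ 1 - t) ht.le (by ring)
  have hm := hmin _ hmem
  have e1 : (1 - t) • u + t • y = u - t • (u - y) := by module
  have e2 : T ((1 - t) • u + t • y) - b = (T u - b) - t • (T u - T y) := by
    simp only [map_add, map_smul]; module
  have e3 : (1 - t) • u + t • y - w = (u - w) - t • (u - y) := by module
  have n2 : ‖T ((1 - t) • u + t • y) - b‖ ^ 2
      = ‖T u - b‖ ^ 2 - 2 * (t * ⟪T u - b, T u - T y⟫) + t ^ 2 * ‖T u - T y‖ ^ 2 := by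
    rw [e2, norm_sub_sq_real, real_inner_smul_right, norm_smul, mul_pow, Real.norm_eq_abs, sq_abs]
  have n3 : ‖(1 - t) • u + t • y - w‖ ^ 2
      = ‖u - w‖ ^ 2 - 2 * (t * ⟪u - w, u - y⟫) + t ^ 2 * ‖u - y‖ ^ 2 := by
    rw [e3, norm_sub_sq_real, real_inner_smul_right, norm_smul, mul_pow, Real.norm_eq_abs, sq_abs]
  have n1 : ⟪c, (1 - t) • u + t • y⟫ = ⟪c, u⟫ - t * ⟪c, u - y⟫ := by
    rw [e1, inner_sub_right, real_inner_smul_right]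
  rw [n1, n2, n3] at hm
  linarith

/-- Change of the squared distance to `p` under a step of relative length `r`. -/
theorem norm_relaxed_step_sub_sq (w u p : E) (r : ℝ) :
    ‖(1 - r) • w + r • u - p‖ ^ 2
      = ‖w - p‖ ^ 2 + 2 * r * ⟪u - w, u - p⟫ - r * (2 - r) * ‖u - w‖ ^ 2 := by
  have h1 : (1 - r) • w + r • u - p = (w - p) + r • (u - w) := by module
  have h2 : u - p = (w - p) + (u - w) := by abel
  rw [h1, h2, norm_add_sq_real, inner_add_right, real_inner_self_eq_norm_sq,
    real_inner_smul_right, norm_smul, mul_pow, Real.norm_eq_abs, sq_abs, real_inner_comm]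
  ring

/-- One accelerated step decreases the averaged objective up to the linearization error. -/
theorem accelerated_step_le [CompleteSpace E] {f g : E → ℝ} {f' : E → E} {L θ : ℝ}
    (hdiff : ∀ x, HasGradientAt f (f' x) x) (hf : ConvexOn ℝ Set.univ f)
    (hg : ConvexOn ℝ Set.univ g)
    (hsmooth : ∀ x x', f x' ≤ f x + ⟪f' x, x' - x⟫ + L / 2 * ‖x' - x‖ ^ 2)
    (h0 : 0 ≤ θ) (h1 : θ ≤ 1) (a w u y m a' : E)
    (hm : m = (1 - θ) • a + θ • w) (ha' : a' = (1 - θ) • a + θ • u) :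
    f a' + g a' ≤ (1 - θ) * (f a + g a) + θ * (f y + g u + ⟪f' m, u - y⟫)
      + L / 2 * θ ^ 2 * ‖u - w‖ ^ 2 := by
  have hga : g a' ≤ (1 - θ) * g a + θ * g u := by
    simpa [ha'] using
      hg.2 (Set.mem_univ a) (Set.mem_univ u) (by linarith : 0 ≤ 1 - θ) h0 (by ring)
  have hs := hsmooth m a'
  have e1 : a' - m = θ • (u - w) := by rw [hm, ha']; module
  have e2 : a' - m = (1 - θ) • (a - m) + θ • ((u - y) + (y - m)) := by rw [ha']; module
  have n1 : ‖a' - m‖ ^ 2 = θ ^ 2 * ‖u - w‖ ^ 2 := by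
    rw [e1, norm_smul, mul_pow, Real.norm_eq_abs, sq_abs]
  have n2 : ⟪f' m, a' - m⟫
      = (1 - θ) * ⟪f' m, a - m⟫ + θ * (⟪f' m, u - y⟫ + ⟪f' m, y - m⟫) := by
    rw [e2]; simp only [inner_add_right, real_inner_smul_right]
  rw [n1, n2] at hs
  have ca := mul_le_mul_of_nonneg_left (hf.add_inner_gradient_le (hdiff m) a)
    (by linarith : 0 ≤ 1 - θ)
  have cy := mul_le_mul_of_nonneg_left (hf.add_inner_gradient_le (hdiff m) y) h0
  linarith

end

/-- Weights of one step with averaging parameter `2 / (s + 1)`. -/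
theorem stepsize_weights {L s θ : ℝ} (hL : 0 ≤ L) (hs : 1 ≤ s) (hθ : θ = 2 / (s + 1)) :
    s * (s + 1) * (1 - θ) = (s - 1) * s ∧ s * (s + 1) * θ = 2 * s ∧
      s * (s + 1) * (L / 2 * θ ^ 2) ≤ 2 * L := by
  have hθs : θ * (s + 1) = 2 := by rw [hθ]; field_simp
  have hθ0 : 0 ≤ θ := by rw [hθ]; positivity
  refine ⟨by linear_combination (-s) * hθs, by linear_combination s * hθs, ?_⟩
  have e : s * (s + 1) * (L / 2 * θ ^ 2) = L * (s * θ) := by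
    linear_combination (L / 2 * θ * s) * hθs
  rw [e]
  linarith [mul_le_mul_of_nonneg_left (by linarith : s * θ ≤ 2) hL]

theorem Matrix.inner_toEuclideanLin_transpose {n l : ℕ} (A : Matrix (Fin l) (Fin n) ℝ)
    (w : EuclideanSpace ℝ (Fin l)) (v : EuclideanSpace ℝ (Fin n)) :
    ⟪Matrix.toEuclideanLin A.transpose w, v⟫ = ⟪w, Matrix.toEuclideanLin A v⟫ := by
  rw [← Matrix.conjTranspose_eq_transpose_of_trivial,
    Matrix.toEuclideanLin_conjTranspose_eq_adjoint, LinearMap.adjoint_inner_left]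

set_option maxHeartbeats 400000 in
theorem glalm_telescoped_bound {n l : ℕ}
    (X : Set (EuclideanSpace ℝ (Fin n))) (hXcl : IsClosed X) (hXcv : Convex ℝ X)
    (f g : EuclideanSpace ℝ (Fin n) → ℝ)
    (f' : EuclideanSpace ℝ (Fin n) → EuclideanSpace ℝ (Fin n))
    (L : ℝ) (hL : 0 ≤ L)
    (hdiff : ∀ x, HasGradientAt f (f' x) x)
    (hfconv : ConvexOn ℝ Set.univ f)
    (hgconv : ConvexOn ℝ Set.univ g)
    (hsmooth : ∀ x x', f x' ≤ f x + ⟪f' x, x' - x⟫ + L / 2 * ‖x' - x‖ ^ 2)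
    (A : Matrix (Fin l) (Fin n) ℝ) (b : EuclideanSpace ℝ (Fin l))
    (xstar : EuclideanSpace ℝ (Fin n)) (hstarX : xstar ∈ X)
    (hstarfeas : Matrix.toEuclideanLin A xstar = b)
    (γ η κ : ℝ) (hγ : 0 < γ) (hη : 0 < η)
    (hα : 2 * L / η ∈ Set.Ioo (0 : ℝ) 1) (hκ : κ ∈ Set.Ioo (1 : ℝ) 2)
    (x xhat xag xmd : ℕ → EuclideanSpace ℝ (Fin n))
    (z zhat : ℕ → EuclideanSpace ℝ (Fin l))
    (hinitX : x 1 ∈ X) (hinit1 : x 1 = xhat 1) (hinit2 : x 1 = xag 1)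
    (hinitz : z 1 = 0) (hinitzhat : zhat 1 = 0)
    (hmd : ∀ k : ℕ, 1 ≤ k →
      xmd k = (1 - 2 / ((k : ℝ) + 1)) • xag k + (2 / ((k : ℝ) + 1)) • xhat k)
    (hxX : ∀ k : ℕ, 1 ≤ k → x (k + 1) ∈ X)
    (hmin : ∀ k : ℕ, 1 ≤ k → ∀ y ∈ X,
      ⟪f' (xmd k) - Matrix.toEuclideanLin A.transpose (zhat k), x (k + 1)⟫ + g (x (k + 1))
          + (κ * γ * (k : ℝ) / 2) / 2 * ‖Matrix.toEuclideanLin A (x (k + 1)) - b‖ ^ 2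
          + η / (2 * (k : ℝ)) * ‖x (k + 1) - xhat k‖ ^ 2
        ≤ ⟪f' (xmd k) - Matrix.toEuclideanLin A.transpose (zhat k), y⟫ + g y
          + (κ * γ * (k : ℝ) / 2) / 2 * ‖Matrix.toEuclideanLin A y - b‖ ^ 2
          + η / (2 * (k : ℝ)) * ‖y - xhat k‖ ^ 2)
    (hhat : ∀ k : ℕ, 1 ≤ k →
      xhat (k + 1) = (2 * L / η - 1) • xhat k + (2 - 2 * L / η) • x (k + 1))
    (hag : ∀ k : ℕ, 1 ≤ k →
      xag (k + 1) = (1 - 2 / ((k : ℝ) + 1)) • xag k + (2 / ((k : ℝ) + 1)) • x (k + 1))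
    (hz : ∀ k : ℕ, 1 ≤ k →
      z (k + 1) = zhat k - ((k : ℝ) * γ) • (Matrix.toEuclideanLin A (x (k + 1)) - b))
    (hzhat : ∀ k : ℕ, 1 ≤ k →
      zhat (k + 1) = (1 - κ) • zhat k + κ • z (k + 1)) :
    ∀ z' : EuclideanSpace ℝ (Fin l), ∀ k : ℕ, 1 ≤ k →
      (k : ℝ) * ((k : ℝ) + 1)
          * ((f (xag (k + 1)) + g (xag (k + 1))) - (f xstar + g xstar)
              - ⟪z', Matrix.toEuclideanLin A (xag (k + 1)) - b⟫)
        ≤ η / (2 - 2 * L / η) * ‖x 1 - xstar‖ ^ 2 + 1 / (κ * γ) * ‖z'‖ ^ 2 := by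
  intro z' k hk
  set T := Matrix.toEuclideanLin A with hT
  set α := 2 * L / η with hα_def
  have hαη : α * η = 2 * L := by rw [hα_def]; field_simp
  have hα2 : 0 < 2 - α := by linarith [hα.2]
  have hκ0 : 0 < κ := by linarith [hκ.1]
  set gap : ℕ → ℝ := fun j => (f (xag j) + g (xag j)) - (f xstar + g xstar)
    - ⟪z', T (xag j) - b⟫ with hgap
  set V : ℕ → ℝ := fun j => η / (2 - α) * ‖xhat j - xstar‖ ^ 2
    + 1 / (κ * γ) * ‖zhat j - z'‖ ^ 2 with hV
  have step : ∀ j : ℕ, 1 ≤ j →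
      (j : ℝ) * ((j : ℝ) + 1) * gap (j + 1) + V (j + 1)
        ≤ ((j : ℝ) - 1) * (j : ℝ) * gap j + V j := by
    intro j hj
    have hj1 : (1 : ℝ) ≤ j := by exact_mod_cast hj
    have hj0 : (0 : ℝ) < j := by linarith
    set s : ℝ := (j : ℝ) with hs
    set θ : ℝ := 2 / (s + 1) with hθ
    set r := T (x (j + 1)) - b with hr
    have hθ0 : 0 ≤ θ := by positivity
    have hθ1 : θ ≤ 1 := by rw [hθ, div_le_one (by linarith)]; linarith
    have hacc := accelerated_step_le hdiff hfconv hgconv hsmooth hθ0 hθ1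
      (xag j) (xhat j) (x (j + 1)) xstar (xmd j) (xag (j + 1)) (hmd j hj) (hag j hj)
    have hfeas : T (xag (j + 1)) - b = (1 - θ) • (T (xag j) - b) + θ • r := by
      rw [hag j hj, hr]; simp only [map_add, map_smul]; module
    have hdual : ⟪z', T (xag (j + 1)) - b⟫
        = (1 - θ) * ⟪z', T (xag j) - b⟫ + θ * ⟪z', r⟫ := by
      rw [hfeas]; simp only [inner_add_right, real_inner_smul_right]
    have hvi := variational_inequality_of_isMinimizer hXcv hgconv T b
      (f' (xmd j) - Matrix.toEuclideanLin A.transpose (zhat j)) (xhat j) (x (j + 1))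
      (κ * γ * s / 2) (η / s) (hxX j hj)
      (by
        have hq : η / s / 2 = η / (2 * s) := by rw [div_div, mul_comm]
        rw [hq]
        exact hmin j hj) hstarX
    rw [hstarfeas, ← hr, real_inner_self_eq_norm_sq, inner_sub_left,
      Matrix.inner_toEuclideanLin_transpose, ← hT, map_sub, hstarfeas, ← hr] at hvi
    have hvi' := mul_le_mul_of_nonneg_left hvi (by positivity : 0 ≤ 2 * s)
    have hηs : 2 * s * (η / s) = 2 * η := by field_simp
    have hprimal : η / (2 - α) * ‖xhat (j + 1) - xstar‖ ^ 2
        = η / (2 - α) * ‖xhat j - xstar‖ ^ 2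
          + 2 * η * ⟪x (j + 1) - xhat j, x (j + 1) - xstar⟫
          - 2 * L * ‖x (j + 1) - xhat j‖ ^ 2 := by
      have e : xhat (j + 1) = (1 - (2 - α)) • xhat j + (2 - α) • x (j + 1) := by
        rw [hhat j hj]; module
      rw [e, norm_relaxed_step_sub_sq, ← hαη]
      field_simp
      ring
    have hmult : 1 / (κ * γ) * ‖zhat (j + 1) - z'‖ ^ 2
        = 1 / (κ * γ) * ‖zhat j - z'‖ ^ 2 - 2 * s * (⟪zhat j, r⟫ - ⟪z', r⟫)
          + κ * γ * s ^ 2 * ‖r‖ ^ 2 := by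
      have e : zhat (j + 1) - z' = (zhat j - z') - (κ * (s * γ)) • r := by
        rw [hzhat j hj, hz j hj]; module
      rw [e, norm_sub_sq_real, real_inner_smul_right, norm_smul, mul_pow, Real.norm_eq_abs,
        sq_abs, inner_sub_left]
      field_simp
    have hgapstep : gap (j + 1) ≤ (1 - θ) * gap j
        + θ * (g (x (j + 1)) - g xstar + ⟪f' (xmd j), x (j + 1) - xstar⟫ - ⟪z', r⟫)
        + L / 2 * θ ^ 2 * ‖x (j + 1) - xhat j‖ ^ 2 := by
      simp only [hgap]
      rw [hdual]
      linarith
    have hscaled := mul_le_mul_of_nonneg_left hgapstep (by positivity : 0 ≤ s * (s + 1))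
    obtain ⟨c1, c2, c3⟩ := stepsize_weights hL hj1 hθ
    have c3' := mul_le_mul_of_nonneg_right c3 (sq_nonneg ‖x (j + 1) - xhat j‖)
    simp only [hV]
    rw [hprimal, hmult]
    linear_combination hscaled + c3' + hvi' + gap j * c1
      + (g (x (j + 1)) - g xstar + ⟪f' (xmd j), x (j + 1) - xstar⟫ - ⟪z', r⟫) * c2
      - ⟪x (j + 1) - xhat j, x (j + 1) - xstar⟫ * hηs
  have hbound : (k : ℝ) * ((k : ℝ) + 1) * gap (k + 1) + V (k + 1) ≤ V 1 := by
    induction k, hk using Nat.le_induction with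
    | base => simpa using step 1 le_rfl
    | succ j hj ih =>
      have := step (j + 1) (by omega)
      push_cast at this ⊢
      linarith
  have hV1 : V 1 = η / (2 - α) * ‖x 1 - xstar‖ ^ 2 + 1 / (κ * γ) * ‖z'‖ ^ 2 := by
    simp [hV, hinit1, hinitzhat]
  have hVnonneg : 0 ≤ V (k + 1) := by positivity
  linarith
end
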